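/- Increment bound (4.20) of Lemma 4.7 for the tree operator ℒ^L along two states: Let N ≥ 1, m ≥ 1 and 1 ≤ L ≤ N be integers. Let f : ℝ^m → ℝ be (L+1) times continuously differentiable with sup_{y} ‖∂^τ f(y)‖ ≤ C^0 for every 0 ≤ τ ≤ L+1, and let c_{L,i} ≥ 0 be real constants indexed by i ∈ A_L. Let y_s, y_u ∈ ℝ^m and, for each ℓ ∈ {1, …, N}, let ξ^ℓ_s, ξ^ℓ_u ∈ ℝ^m; set a_ℓ = ‖ξ^ℓ_s‖ and P^ℓ_s = P^ℓ(a). Let ε be a real number with 0 ≤ ε ≤ 1/2, and let K^0, K^1, …, K^N be real constants with K^ℓ ≥ 1 for all ℓ. Assume ‖y_u − y_s‖ ≤ K^0·ε and ‖ξ^ℓ_u − ξ^ℓ_s‖ ≤ K^ℓ·P^ℓ_s·ε for every ℓ ∈ {1, …, N}. Define ℒ^L f(y_v; ξ_v) = ∑_{i ∈ A_L} c_{L,i} · ∂^{ℓ_1^i} f(y_v)[ξ^{ℓ_2^i}_v, …, ξ^{ℓ_{α_i}^i}_v] for v ∈ {s, u}. Then |ℒ^L f(y_u; ξ_u) − ℒ^L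 f(y_s; ξ_s)| ≤ C^5_{f,L} · P^L_s · ε, where C^5_{f,L} = 2·∑_{i ∈ A_L} c_{L,i}·C^0·(K^0 + ∑_{r=2}^{α_i} K^{ℓ_r^i})·(1 + C^4_L) and C^4_L = max { 2^{L+1}·K^{q_1} ⋯ K^{q_k} : k ≥ 1, q_1, …, q_k positive integers with q_1 + ⋯ + q_k = L }. -/

import Mathlib

/-- A branch of length `N`: a sequence `i_1, …, i_N` of positive integers (encoded as a
function `ℕ → ℕ` vanishing outside `{1, …, N}`) such that `i_1 = 1` and, for every
`1 ≤ τ < N`, `i_{τ+1} ≤ 1 + #{σ ∈ {1,…,τ} : i_σ = 1}`.  `A_N` is the set of branches of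
length `N`. -/
def IsBranch (N : ℕ) (i : ℕ → ℕ) : Prop :=
  i 1 = 1 ∧
  (∀ τ, 1 ≤ τ → τ ≤ N → 1 ≤ i τ) ∧
  (∀ τ, 1 ≤ τ → τ < N →
    i (τ + 1) ≤ 1 + ((Finset.Icc 1 τ).filter (fun σ => i σ = 1)).card) ∧
  (∀ τ, τ = 0 ∨ N < τ → i τ = 0)

/-- `ell N i r = ℓ_r^i`: for `r = 1` the number of `1`'s in the branch `i` of length `N`,
and for `r ≥ 2` one plus the number of `r`'s in `i`. -/
def ell (N : ℕ) (i : ℕ → ℕ) (r : ℕ) : ℕ :=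
  if r = 1 then ((Finset.Icc 1 N).filter (fun τ => i τ = 1)).card
  else 1 + ((Finset.Icc 1 N).filter (fun τ => i τ = r)).card

/-- `alpha N i = α_i = ℓ_1^i + 1`. -/
def alpha (N : ℕ) (i : ℕ → ℕ) : ℕ := ell N i 1 + 1

/-- `Pmax a L = P^L(a)`: the maximum of `1` and of all products `a_{q_1} ⋯ a_{q_k}` over
nonempty tuples `(q_1, …, q_k)` of positive integers with `q_1 + ⋯ + q_k ≤ L`. -/
noncomputable def Pmax (a : ℕ → ℝ) (L : ℕ) : ℝ :=
  sSup (insert (1 : ℝ)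
    {x : ℝ | ∃ l : List ℕ, l ≠ [] ∧ (∀ q ∈ l, 1 ≤ q) ∧ l.sum ≤ L ∧ x = (l.map a).prod})

/-- `C^4_L = max { 2^{L+1} · K_{q_1} ⋯ K_{q_k} }`, the maximum running over nonempty tuples
`(q_1, …, q_k)` of positive integers with `q_1 + ⋯ + q_k = L`. -/
noncomputable def CfourConst (K : ℕ → ℝ) (L : ℕ) : ℝ :=
  sSup {x : ℝ | ∃ l : List ℕ, l ≠ [] ∧ (∀ q ∈ l, 1 ≤ q) ∧ l.sum = L ∧
    x = 2 ^ (L + 1) * (l.map K).prod}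

/-- `ℒ^L f(y; ξ) = ∑_{i ∈ A_L} c_{L,i} · ∂^{ℓ_1^i} f(y)[ξ^{ℓ_2^i}, …, ξ^{ℓ_{α_i}^i}]`. -/
noncomputable def treeOp (m : ℕ) (c : (ℕ → ℕ) → ℝ) (f : (Fin m → ℝ) → ℝ)
    (L : ℕ) (y : Fin m → ℝ) (ξ : ℕ → Fin m → ℝ) : ℝ :=
  ∑ᶠ i ∈ {i : ℕ → ℕ | IsBranch L i},
    c i * iteratedFDeriv ℝ (ell L i 1) f y
      (fun j : Fin (ell L i 1) => ξ (ell L i ((j : ℕ) + 2)))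

/-- Only finitely many lists of positive integers have sum at most `L`. -/
theorem finite_setOf_pos_list_sum_le (L : ℕ) :
    {l : List ℕ | (∀ q ∈ l, 1 ≤ q) ∧ l.sum ≤ L}.Finite := by
  refine ((Finset.range (L + 1)).finite_toSet.biUnion fun n _ =>
    Set.finite_range (Composition.blocks (n := n))).subset ?_
  rintro l ⟨hl, hs⟩
  simp only [Set.mem_iUnion, Set.mem_range]
  exact ⟨l.sum, by simpa using Nat.lt_succ_of_le hs, ⟨l, fun h => hl _ h, rfl⟩, rfl⟩

theorem finite_Pmax_set (a : ℕ → ℝ) (L : ℕ) :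
    (insert (1 : ℝ) {x : ℝ | ∃ l : List ℕ, l ≠ [] ∧ (∀ q ∈ l, 1 ≤ q) ∧ l.sum ≤ L ∧
      x = (l.map a).prod}).Finite := by
  refine Set.Finite.insert _ (((finite_setOf_pos_list_sum_le L).image
    fun l => (l.map a).prod).subset ?_)
  rintro x ⟨l, -, h1, h2, rfl⟩
  exact ⟨l, ⟨h1, h2⟩, rfl⟩

theorem prod_le_Pmax (a : ℕ → ℝ) {L : ℕ} {l : List ℕ} (hl : ∀ q ∈ l, 1 ≤ q)
    (hs : l.sum ≤ L) : (l.map a).prod ≤ Pmax a L := by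
  refine le_csSup (finite_Pmax_set a L).bddAbove ?_
  by_cases h : l = []
  · simp [h]
  · exact Or.inr ⟨l, h, hl, hs, rfl⟩

theorem one_le_Pmax (a : ℕ → ℝ) (L : ℕ) : 1 ≤ Pmax a L :=
  prod_le_Pmax a (l := []) (by simp) (by simp)

theorem le_Pmax (a : ℕ → ℝ) {q : ℕ} (hq : 1 ≤ q) : a q ≤ Pmax a q := by
  simpa using prod_le_Pmax a (l := [q]) (L := q) (by simpa using hq) (by simp)

theorem exists_prod_eq_Pmax (a : ℕ → ℝ) (L : ℕ) :
    ∃ l : List ℕ, (∀ q ∈ l, 1 ≤ q) ∧ l.sum ≤ L ∧ Pmax a L = (l.map a).prod := by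
  rcases (Set.insert_nonempty _ _).csSup_mem (finite_Pmax_set a L) with h | ⟨l, -, h1, h2, h⟩
  · exact ⟨[], by simp, by simp, by simpa [Pmax] using h⟩
  · exact ⟨l, h1, h2, h⟩

theorem Pmax_mul_Pmax_le (a : ℕ → ℝ) (p q : ℕ) : Pmax a p * Pmax a q ≤ Pmax a (p + q) := by
  obtain ⟨l, hl, hls, h⟩ := exists_prod_eq_Pmax a p
  obtain ⟨l', hl', hls', h'⟩ := exists_prod_eq_Pmax a q
  rw [h, h', ← List.prod_append, ← List.map_append]
  refine prod_le_Pmax a (fun r hr => ?_) (by rw [List.sum_append]; omega)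
  rcases List.mem_append.1 hr with hr | hr
  exacts [hl r hr, hl' r hr]

theorem prod_Pmax_le {ι : Type*} (a : ℕ → ℝ) (s : Finset ι) (e : ι → ℕ) :
    ∏ j ∈ s, Pmax a (e j) ≤ Pmax a (∑ j ∈ s, e j) := by
  classical
  induction s using Finset.induction_on with
  | empty => simpa using one_le_Pmax a 0
  | insert x s hx ih =>
    rw [Finset.prod_insert hx, Finset.sum_insert hx]
    exact (mul_le_mul_of_nonneg_left ih (zero_le_one.trans (one_le_Pmax a _))).trans
      (Pmax_mul_Pmax_le a _ _)

theorem two_pow_mul_prod_le_CfourConst (K : ℕ → ℝ) {k L : ℕ} (e : Fin k → ℕ) (hk : k ≠ 0)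
    (he : ∀ j, 1 ≤ e j) (hs : ∑ j, e j = L) :
    2 ^ (L + 1) * ∏ j, K (e j) ≤ CfourConst K L := by
  refine le_csSup ?_ ⟨List.ofFn e, ?_, ?_, ?_, ?_⟩
  · refine (((finite_setOf_pos_list_sum_le L).image
      fun l => 2 ^ (L + 1) * (l.map K).prod).subset ?_).bddAbove
    rintro x ⟨l, -, h1, h2, rfl⟩
    exact ⟨l, ⟨h1, h2.le⟩, rfl⟩
  · simpa using hk
  · intro q hq
    obtain ⟨j, rfl⟩ := (List.mem_ofFn' _ _).1 hq
    exact he j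
  · rw [List.sum_ofFn, hs]
  · rw [List.map_ofFn, List.prod_ofFn]; rfl

namespace IsBranch

variable {L : ℕ} {i : ℕ → ℕ}

theorem le_alpha (h : IsBranch L i) {τ : ℕ} (h1 : 1 ≤ τ) (hτ : τ ≤ L) : i τ ≤ alpha L i := by
  obtain ⟨hi1, -, hstep, -⟩ := h
  rcases τ with _ | _ | τ
  · omega
  · simp only [zero_add, hi1]; unfold alpha; omega
  · refine (hstep (τ + 1) (by omega) (by omega)).trans ?_
    rw [alpha, ell, if_pos rfl, add_comm]
    gcongr
    omega

theorem ell_one_ne_zero (h : IsBranch L i) (hL : 1 ≤ L) : ell L i 1 ≠ 0 := by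
  rw [ell, if_pos rfl]
  exact Finset.card_ne_zero_of_mem (a := 1) (by simp [h.1, hL])

theorem ell_one_le (L : ℕ) (i : ℕ → ℕ) : ell L i 1 ≤ L := by
  rw [ell, if_pos rfl]
  exact (Finset.card_filter_le _ _).trans (by simp)

theorem sum_ell (h : IsBranch L i) : ∑ r ∈ Finset.Icc 2 (alpha L i), ell L i r = L := by
  have key : L = ∑ r ∈ Finset.Icc 1 (alpha L i),
      ((Finset.Icc 1 L).filter (fun τ => i τ = r)).card := by
    rw [← Finset.card_eq_sum_card_fiberwise]
    · simp
    · intro τ hτ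
      simp only [Finset.coe_Icc, Set.mem_Icc] at hτ ⊢
      exact ⟨h.2.1 τ hτ.1 hτ.2, h.le_alpha hτ.1 hτ.2⟩
  have h1 : 1 ≤ alpha L i := by unfold alpha; omega
  rw [← Finset.add_sum_Ioc_eq_sum_Icc h1] at key
  have h2 : ∀ r ∈ Finset.Icc 2 (alpha L i),
      ell L i r = 1 + ((Finset.Icc 1 L).filter (fun τ => i τ = r)).card := by
    intro r hr
    rw [ell, if_neg]
    have := Finset.mem_Icc.1 hr
    omega
  have h3 : Finset.Ioc 1 (alpha L i) = Finset.Icc 2 (alpha L i) := rfl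
  rw [Finset.sum_congr rfl h2, Finset.sum_add_distrib]
  rw [h3] at key
  have h4 : ell L i 1 = ((Finset.Icc 1 L).filter (fun τ => i τ = 1)).card := by
    rw [ell, if_pos rfl]
  simp only [Finset.sum_const, Nat.card_Icc, smul_eq_mul, mul_one]
  unfold alpha at key ⊢
  omega

end IsBranch

theorem sum_Icc_two_alpha {M : Type*} [AddCommMonoid M] (L : ℕ) (i : ℕ → ℕ) (g : ℕ → M) :
    ∑ r ∈ Finset.Icc 2 (alpha L i), g r = ∑ j : Fin (ell L i 1), g ((j : ℕ) + 2) := by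
  rw [Fin.sum_univ_eq_sum_range (fun n => g (n + 2)), Finset.range_eq_Ico,
    Finset.sum_Ico_add' g 0 (ell L i 1) 2]
  refine Finset.sum_congr ?_ fun _ _ => rfl
  ext r
  simp only [Finset.mem_Icc, Finset.mem_Ico, alpha]
  omega

theorem finite_setOf_isBranch (L : ℕ) : {i : ℕ → ℕ | IsBranch L i}.Finite := by
  refine Set.Finite.of_injOn (f := fun i (τ : Fin (L + 1)) => i τ)
    (t := Set.univ.pi fun _ => Set.Iic (L + 1)) ?_ ?_ (Set.Finite.pi fun _ => Set.finite_Iic _)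
  · intro i hi τ _
    by_cases h0 : (τ : ℕ) = 0
    · simp [hi.2.2.2 τ (Or.inl h0)]
    · have h1 := hi.le_alpha (τ := τ) (by omega) (by omega)
      have h2 := IsBranch.ell_one_le L i
      simp only [Set.mem_Iic, alpha] at h1 ⊢
      omega
  · intro i hi i' hi' h
    funext τ
    by_cases hτ : τ ≤ L
    · exact congrFun h ⟨τ, by omega⟩
    · rw [hi.2.2.2 τ (Or.inr (by omega)), hi'.2.2.2 τ (Or.inr (by omega))]

theorem norm_iteratedFDeriv_sub_le {E F : Type*} [NormedAddCommGroup E] [NormedSpace ℝ E]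
    [NormedAddCommGroup F] [NormedSpace ℝ F] {f : E → F} {k : ℕ} {C : ℝ}
    (hf : ContDiff ℝ (k + 1) f) (hC : ∀ y, ‖iteratedFDeriv ℝ (k + 1) f y‖ ≤ C) (x y : E) :
    ‖iteratedFDeriv ℝ k f y - iteratedFDeriv ℝ k f x‖ ≤ C * ‖y - x‖ := by
  refine convex_univ.norm_image_sub_le_of_norm_fderiv_le (𝕜 := ℝ) (fun z _ => ?_)
    (fun z _ => ?_) (Set.mem_univ x) (Set.mem_univ y)
  · exact hf.differentiable_iteratedFDeriv (by exact_mod_cast Nat.lt_succ_self k) z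
  · rw [norm_fderiv_iteratedFDeriv]
    exact hC z

/-- Increment bound for one summand of the tree operator: the branch enters only through the
tuple `e` of superscripts, which has positive entries summing to `L`. -/
theorem abs_iteratedFDeriv_apply_sub_le {E : Type*} [NormedAddCommGroup E] [NormedSpace ℝ E]
    {k L : ℕ} (hk : k ≠ 0) (hkL : k ≤ L) {f : E → ℝ} {C : ℝ} (hf : ContDiff ℝ (k + 1) f)
    (hCk : ∀ y, ‖iteratedFDeriv ℝ k f y‖ ≤ C)
    (hCk' : ∀ y, ‖iteratedFDeriv ℝ (k + 1) f y‖ ≤ C)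
    (e : Fin k → ℕ) (he : ∀ j, 1 ≤ e j) (hs : ∑ j, e j = L)
    {ys yu : E} {ξs ξu : ℕ → E} {ε : ℝ} (hε0 : 0 ≤ ε) (hε : ε ≤ 1 / 2)
    {K : ℕ → ℝ} (hK : ∀ q, q ≤ L → 1 ≤ K q) (hy : ‖yu - ys‖ ≤ K 0 * ε)
    (hξ : ∀ q, 1 ≤ q → q ≤ L →
      ‖ξu q - ξs q‖ ≤ K q * Pmax (fun q' => ‖ξs q'‖) q * ε) :
    |iteratedFDeriv ℝ k f yu (fun j => ξu (e j)) - iteratedFDeriv ℝ k f ys (fun j => ξs (e j))| ≤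
      C * (K 0 + ∑ j, K (e j)) * (1 + CfourConst K L) * Pmax (fun q' => ‖ξs q'‖) L * ε := by
  set P := Pmax (fun q' => ‖ξs q'‖) with hP
  have hC0 : 0 ≤ C := (norm_nonneg _).trans (hCk ys)
  have heL : ∀ j, e j ≤ L := fun j =>
    hs ▸ Finset.single_le_sum (f := e) (fun _ _ => Nat.zero_le _) (Finset.mem_univ j)
  have hKe : ∀ j, 1 ≤ K (e j) := fun j => hK _ (heL j)
  have hP1 : ∀ q, 1 ≤ P q := one_le_Pmax _
  have hPL : ∏ j, P (e j) ≤ P L := hs ▸ prod_Pmax_le _ Finset.univ e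
  have hC4 : 2 ^ (L + 1) * ∏ j, K (e j) ≤ CfourConst K L :=
    two_pow_mul_prod_le_CfourConst K e hk he hs
  have hprodK : 0 ≤ ∏ j, K (e j) := Finset.prod_nonneg fun j _ => zero_le_one.trans (hKe j)
  have hC40 : 0 ≤ CfourConst K L := le_trans (by positivity) hC4
  have hK0 : 1 ≤ K 0 := hK 0 (Nat.zero_le _)
  have hPL0 : 0 ≤ P L := zero_le_one.trans (hP1 L)
  have hs_le : ∀ j, ‖ξs (e j)‖ ≤ P (e j) := fun j => le_Pmax (fun q' => ‖ξs q'‖) (he j)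
  have hmax : ∀ j, max ‖ξu (e j)‖ ‖ξs (e j)‖ ≤ 2 * K (e j) * P (e j) := by
    intro j
    have hKP : P (e j) ≤ K (e j) * P (e j) :=
      le_mul_of_one_le_left (zero_le_one.trans (hP1 _)) (hKe j)
    have hKP0 : 0 ≤ K (e j) * P (e j) := (zero_le_one.trans (hP1 _)).trans hKP
    have h1 : K (e j) * P (e j) * ε ≤ K (e j) * P (e j) := mul_le_of_le_one_right hKP0 (by linarith)
    have h2 := hξ _ (he j) (heL j)
    have h3 := norm_le_norm_add_norm_sub' (ξu (e j)) (ξs (e j))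
    have h4 := hs_le j
    exact max_le (by linarith) (by linarith)
  have hterm : ∀ r, (∏ j, if j = r then ‖ξu (e r) - ξs (e r)‖ else
      max ‖ξu (e j)‖ ‖ξs (e j)‖) ≤ K (e r) * (CfourConst K L * P L * ε) := by
    intro r
    calc (∏ j, if j = r then ‖ξu (e r) - ξs (e r)‖ else max ‖ξu (e j)‖ ‖ξs (e j)‖)
        ≤ ∏ j, (if j = r then ε else 1) * (2 * (K (e j) * P (e j))) := by
          refine Finset.prod_le_prod (fun j _ => by split_ifs <;> positivity) fun j _ => ?_
          split_ifs with h
          · subst h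
            have h1 : 0 ≤ K (e j) * P (e j) * ε :=
              mul_nonneg (mul_nonneg (zero_le_one.trans (hKe j)) (zero_le_one.trans (hP1 _))) hε0
            linarith [hξ _ (he j) (heL j)]
          · linarith [hmax j]
      _ = (2 ^ k * ∏ j, K (e j)) * (∏ j, P (e j)) * ε := by
          rw [Finset.prod_mul_distrib, Finset.prod_mul_distrib, Finset.prod_mul_distrib,
            Finset.prod_ite_eq' Finset.univ r]
          simp
          ring
      _ ≤ CfourConst K L * P L * ε := by
          have h2 : (2 : ℝ) ^ k * ∏ j, K (e j) ≤ CfourConst K L := by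
            refine le_trans ?_ hC4
            gcongr
            · norm_num
            · omega
          have h3 : 0 ≤ ∏ j, P (e j) := Finset.prod_nonneg fun j _ => zero_le_one.trans (hP1 _)
          gcongr
      _ ≤ K (e r) * (CfourConst K L * P L * ε) :=
          le_mul_of_one_le_left (by positivity) (hKe r)
  have hargs : |iteratedFDeriv ℝ k f yu (fun j => ξu (e j)) -
      iteratedFDeriv ℝ k f yu (fun j => ξs (e j))| ≤
      C * ((∑ j, K (e j)) * (CfourConst K L * P L * ε)) := by
    refine ((iteratedFDeriv ℝ k f yu).norm_image_sub_le' _ _).trans ?_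
    rw [Finset.sum_mul]
    refine mul_le_mul (hCk yu) (Finset.sum_le_sum fun r _ => hterm r) ?_ hC0
    exact Finset.sum_nonneg fun r _ => Finset.prod_nonneg fun j _ => by split_ifs <;> positivity
  have hbase : |iteratedFDeriv ℝ k f yu (fun j => ξs (e j)) -
      iteratedFDeriv ℝ k f ys (fun j => ξs (e j))| ≤ C * (K 0 * ε) * P L := by
    have h := (iteratedFDeriv ℝ k f yu - iteratedFDeriv ℝ k f ys).le_opNorm fun j => ξs (e j)
    refine h.trans (mul_le_mul ?_ ?_ (by positivity) (by positivity))
    · exact (norm_iteratedFDeriv_sub_le hf hCk' ys yu).trans (by gcongr)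
    · exact (Finset.prod_le_prod (fun _ _ => norm_nonneg _) fun j _ => hs_le j).trans hPL
  have hsum0 : 0 ≤ ∑ j, K (e j) := Finset.sum_nonneg fun j _ => zero_le_one.trans (hKe j)
  have hrest : 0 ≤ C * (K 0 * CfourConst K L + ∑ j, K (e j)) * P L * ε := by positivity
  refine (abs_sub_le _ (iteratedFDeriv ℝ k f yu fun j => ξs (e j)) _).trans ?_
  linarith

/-- **Increment bound (4.20) of Lemma 4.7 for the tree operator `ℒ^L` along two states.**
With `a_ℓ = ‖ξ^ℓ_s‖` (max-norm), `P^ℓ_s = P^ℓ(a)`, `0 ≤ ε ≤ 1/2`, constants `K^ℓ ≥ 1`,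
`‖y_u − y_s‖ ≤ K⁰·ε` and `‖ξ^ℓ_u − ξ^ℓ_s‖ ≤ K^ℓ·P^ℓ_s·ε` for `1 ≤ ℓ ≤ N`, one has
`|ℒ^L f(y_u; ξ_u) − ℒ^L f(y_s; ξ_s)| ≤ C⁵_{f,L}·P^L_s·ε`, where
`C⁵_{f,L} = 2·∑_{i ∈ A_L} c_{L,i}·C⁰·(K⁰ + ∑_{r=2}^{α_i} K^{ℓ_r^i})·(1 + C⁴_L)`. -/
theorem tree_operator_increment_bound
    (N m L : ℕ) (hN : 1 ≤ N) (hm : 1 ≤ m) (hL1 : 1 ≤ L) (hLN : L ≤ N)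
    (f : (Fin m → ℝ) → ℝ) (C0 : ℝ)
    (hf : ContDiff ℝ (L + 1) f)
    (hC : ∀ τ : ℕ, τ ≤ L + 1 → ∀ y, ‖iteratedFDeriv ℝ τ f y‖ ≤ C0)
    (c : (ℕ → ℕ) → ℝ) (hc : ∀ i, IsBranch L i → 0 ≤ c i)
    (ys yu : Fin m → ℝ) (ξs ξu : ℕ → Fin m → ℝ)
    (ε : ℝ) (hε0 : 0 ≤ ε) (hε : ε ≤ 1 / 2)
    (K : ℕ → ℝ) (hK : ∀ q, q ≤ N → 1 ≤ K q)
    (hy : ‖yu - ys‖ ≤ K 0 * ε)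
    (hξ : ∀ q, 1 ≤ q → q ≤ N →
      ‖ξu q - ξs q‖ ≤ K q * Pmax (fun q' => ‖ξs q'‖) q * ε) :
    |treeOp m c f L yu ξu - treeOp m c f L ys ξs| ≤
      (2 * ∑ᶠ i ∈ {i : ℕ → ℕ | IsBranch L i},
        c i * C0 * (K 0 + ∑ r ∈ Finset.Icc 2 (alpha L i), K (ell L i r)) *
          (1 + CfourConst K L)) *
        Pmax (fun q' => ‖ξs q'‖) L * ε := by
  have hfin := finite_setOf_isBranch L
  unfold treeOp
  simp only [finsum_mem_eq_finite_toFinset_sum _ hfin]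
  rw [← Finset.sum_sub_distrib]
  have hterm : ∀ i ∈ hfin.toFinset,
      |c i * iteratedFDeriv ℝ (ell L i 1) f yu (fun j => ξu (ell L i ((j : ℕ) + 2))) -
        c i * iteratedFDeriv ℝ (ell L i 1) f ys (fun j => ξs (ell L i ((j : ℕ) + 2)))| ≤
      c i * C0 * (K 0 + ∑ r ∈ Finset.Icc 2 (alpha L i), K (ell L i r)) *
        (1 + CfourConst K L) * (Pmax (fun q' => ‖ξs q'‖) L * ε) := by
    intro i hi
    have hi : IsBranch L i := hfin.mem_toFinset.1 hi
    have hle := IsBranch.ell_one_le L i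
    have h := abs_iteratedFDeriv_apply_sub_le (L := L) (hi.ell_one_ne_zero hL1) hle
      (hf.of_le (by exact_mod_cast Nat.succ_le_succ hle)) (hC _ (by omega)) (hC _ (by omega))
      (fun j : Fin (ell L i 1) => ell L i ((j : ℕ) + 2))
      (fun j => by rw [ell, if_neg (by omega)]; omega)
      (by rw [← sum_Icc_two_alpha L i (ell L i), hi.sum_ell]) hε0 hε
      (fun q hq => hK q (hq.trans hLN)) hy (fun q h1 hq => hξ q h1 (hq.trans hLN))
    rw [← mul_sub, abs_mul, abs_of_nonneg (hc i hi),
      sum_Icc_two_alpha L i fun r => K (ell L i r)]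
    exact (mul_le_mul_of_nonneg_left h (hc i hi)).trans_eq (by ring)
  have hsum := (Finset.abs_sum_le_sum_abs _ _).trans (Finset.sum_le_sum hterm)
  rw [← Finset.sum_mul] at hsum
  have h0 := (abs_nonneg _).trans hsum
  linarith
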